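/- arXiv:1504.03844 — 8 statements merged into one kernel-verified Lean document; each statement's English description precedes it below -/
import Mathlib

section
/- Fix an integer K ≥ 1 and a real a > 0. For all reals ρ_V ≥ 0 and ρ_R with 0 ≤ ρ_R < a, if f(ρ_V,ρ_R) = 0 then (a − ρ_R)·Σ_{k=0}^{K} ρ_V^k ρ_R^{K-k}/(K-k)! ≥ a·ρ_R^K/K!. -/
open Finset

/-- Partition function `Z(ρ_V, ρ_R) = Σ_{k+l ≤ K} ρ_V^k ρ_R^l / l!`. -/
noncomputable def Z (K : ℕ) (x r : ℝ) : ℝ :=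
  ∑ k ∈ Finset.range (K + 1), ∑ l ∈ Finset.range (K + 1 - k),
    x ^ k * r ^ l / (Nat.factorial l : ℝ)

/-- Stationary probability `π_{k,l}`. -/
noncomputable def piP (K : ℕ) (x r : ℝ) (k l : ℕ) : ℝ :=
  x ^ k * r ^ l / ((Nat.factorial l : ℝ) * Z K x r)

/-- `π_{0,·}` : probability of an empty station (no vehicles). -/
noncomputable def piZero (K : ℕ) (x r : ℝ) : ℝ :=
  ∑ l ∈ Finset.range (K + 1), piP K x r 0 l

/-- `π_S` : probability of a saturated station. -/
noncomputable def piSat (K : ℕ) (x r : ℝ) : ℝ :=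
  ∑ k ∈ Finset.range (K + 1), piP K x r k (K - k)

/-- Mean occupancy `s̃(ρ_V,ρ_R)`. -/
noncomputable def sTilde (K : ℕ) (x r : ℝ) : ℝ :=
  (∑ k ∈ Finset.range (K + 1), ∑ l ∈ Finset.range (K + 1 - k),
    ((k : ℝ) + (l : ℝ)) * (x ^ k * r ^ l / (Nat.factorial l : ℝ))) / Z K x r

/-- `f(ρ_V,ρ_R) = (a − ρ_R)·Z(ρ_V,ρ_R) − a·Σ_{l=0}^K ρ_R^l/l!`. -/
noncomputable def fEq (K : ℕ) (a x r : ℝ) : ℝ :=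
  (a - r) * Z K x r - a * ∑ l ∈ Finset.range (K + 1), r ^ l / (Nat.factorial l : ℝ)

/-- Proportion of problematic stations `P_b`. -/
noncomputable def Pb (K : ℕ) (x r : ℝ) : ℝ :=
  piZero K x r + piSat K x r - piP K x r 0 K

/-- Upper bound `P_b^+`. -/
noncomputable def PbPlus (K : ℕ) (x r : ℝ) : ℝ :=
  piZero K x r + piSat K x r

theorem factorial_mul_factorial_add_le {l m : ℕ} (h : l ≤ m) (k : ℕ) :
    m.factorial * (l + k).factorial ≤ l.factorial * (m + k).factorial := by
  induction k with
  | zero => simp [mul_comm]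
  | succ k ih =>
    rw [← add_assoc, ← add_assoc, Nat.factorial_succ, Nat.factorial_succ]
    calc m.factorial * ((l + k + 1) * (l + k).factorial)
        = (l + k + 1) * (m.factorial * (l + k).factorial) := by ring
      _ ≤ (m + k + 1) * (l.factorial * (m + k).factorial) := by gcongr
      _ = l.factorial * ((m + k + 1) * (m + k).factorial) := by ring

theorem pow_div_factorial_mul_le {r : ℝ} (hr : 0 ≤ r) {l m : ℕ} (h : l ≤ m) (k : ℕ) :
    r ^ l / (l.factorial : ℝ) * (r ^ (m + k) / ((m + k).factorial : ℝ)) ≤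
      r ^ m / (m.factorial : ℝ) * (r ^ (l + k) / ((l + k).factorial : ℝ)) := by
  have hfac : (m.factorial * (l + k).factorial : ℝ) ≤ l.factorial * (m + k).factorial := by
    exact_mod_cast factorial_mul_factorial_add_le h k
  rw [div_mul_div_comm, div_mul_div_comm,
    show r ^ l * r ^ (m + k) = r ^ m * r ^ (l + k) by ring]
  gcongr

theorem partition_mul_le {x r : ℝ} (hx : 0 ≤ x) (hr : 0 ≤ r) (K : ℕ) :
    Z K x r * (r ^ K / (K.factorial : ℝ)) ≤
      (∑ k ∈ Finset.range (K + 1), x ^ k * r ^ (K - k) / ((K - k).factorial : ℝ)) *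
        ∑ l ∈ Finset.range (K + 1), r ^ l / (l.factorial : ℝ) := by
  rw [Z, Finset.sum_mul, Finset.sum_mul]
  refine Finset.sum_le_sum fun k hk => ?_
  obtain ⟨m, rfl⟩ := Nat.exists_eq_add_of_le' (Finset.mem_range_succ_iff.mp hk)
  rw [Nat.add_sub_cancel, show m + k + 1 - k = m + 1 by omega]
  have hsub : ∑ l ∈ Finset.range (m + 1), r ^ (l + k) / ((l + k).factorial : ℝ) ≤
      ∑ l ∈ Finset.range (m + k + 1), r ^ l / (l.factorial : ℝ) := by
    rw [show m + k + 1 = k + (m + 1) by omega, Finset.sum_range_add _ k (m + 1)]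
    simp_rw [fun l => add_comm k l]
    exact le_add_of_nonneg_left (Finset.sum_nonneg fun _ _ => by positivity)
  refine le_trans ?_ (mul_le_mul_of_nonneg_left hsub (by positivity))
  rw [Finset.sum_mul, Finset.mul_sum]
  refine Finset.sum_le_sum fun l hl => ?_
  rw [mul_div_assoc, mul_div_assoc, mul_assoc, mul_assoc]
  exact mul_le_mul_of_nonneg_left
    (pow_div_factorial_mul_le hr (Finset.mem_range_succ_iff.mp hl) k) (by positivity)

/-- If f(x,r) = 0 then (a - r) * sum_{k=0}^K x^k r^(K-k)/(K-k)! ≥ a r^K/K!. -/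
theorem stmt_5 (K : ℕ) (hK : 1 ≤ K) (a : ℝ) (ha : 0 < a) (x r : ℝ)
    (hx : 0 ≤ x) (hr0 : 0 ≤ r) (hra : r < a) (hf : fEq K a x r = 0) :
    (a - r) * ∑ k ∈ Finset.range (K + 1),
        x ^ k * r ^ (K - k) / (Nat.factorial (K - k) : ℝ)
      ≥ a * r ^ K / (Nat.factorial K : ℝ) := by
  have hC : 0 < ∑ l ∈ Finset.range (K + 1), r ^ l / (Nat.factorial l : ℝ) := by
    rw [Finset.sum_range_succ']
    exact add_pos_of_nonneg_of_pos (Finset.sum_nonneg fun _ _ => by positivity) (by simp)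
  have hZ := mul_le_mul_of_nonneg_left (partition_mul_le hx hr0 K) (sub_pos.mpr hra).le
  rw [← mul_assoc, ← mul_assoc, sub_eq_zero.mp hf] at hZ
  refine le_of_mul_le_mul_right (le_of_eq_of_le ?_ hZ) hC
  ring
end

section
/- Fix an integer K ≥ 1 and a real a > 0. For all reals ρ_V ≥ 0 and ρ_R with 0 ≤ ρ_R < a, if f(ρ_V,ρ_R) = 0 then the partial derivative of f with respect to ρ_R at (ρ_V,ρ_R) is strictly negative: deriv (r ↦ f(ρ_V,r)) ρ_R < 0. -/
open Finset

/-- Partial sum `Σ_{l < n} r^l / l!` of the exponential series. -/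
noncomputable def expPartialSum (n : ℕ) (r : ℝ) : ℝ :=
  ∑ l ∈ Finset.range n, r ^ l / (Nat.factorial l : ℝ)

lemma expPartialSum_succ (n : ℕ) (r : ℝ) :
    expPartialSum (n + 1) r = expPartialSum n r + r ^ n / (Nat.factorial n : ℝ) :=
  Finset.sum_range_succ _ _

lemma expPartialSum_nonneg (n : ℕ) {r : ℝ} (hr : 0 ≤ r) : 0 ≤ expPartialSum n r :=
  Finset.sum_nonneg fun _ _ => by positivity

lemma one_le_expPartialSum_succ (n : ℕ) {r : ℝ} (hr : 0 ≤ r) : 1 ≤ expPartialSum (n + 1) r := by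
  induction n with
  | zero => simp [expPartialSum]
  | succ n ih =>
    rw [expPartialSum_succ]
    have : 0 ≤ r ^ (n + 1) / (Nat.factorial (n + 1) : ℝ) := by positivity
    linarith

lemma pow_succ_div_factorial_succ (n : ℕ) (r : ℝ) :
    (n + 1 : ℝ) * (r ^ (n + 1) / (Nat.factorial (n + 1) : ℝ)) =
      r * (r ^ n / (Nat.factorial n : ℝ)) := by
  have := Nat.factorial_ne_zero n
  rw [Nat.factorial_succ]
  push_cast
  field_simp
  ring

lemma hasDerivAt_expPartialSum (n : ℕ) (r : ℝ) :
    HasDerivAt (expPartialSum n) (expPartialSum (n - 1) r) r := by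
  cases n with
  | zero =>
    have : expPartialSum 0 = fun _ => 0 := by ext; simp [expPartialSum]
    simpa [this] using hasDerivAt_const r (0 : ℝ)
  | succ n =>
    induction n with
    | zero =>
      have : expPartialSum (0 + 1) = fun _ => 1 := by ext; simp [expPartialSum]
      simpa [this, expPartialSum] using hasDerivAt_const r (1 : ℝ)
    | succ n ih =>
      have h : expPartialSum (n + 1 + 1) =
          fun t => expPartialSum (n + 1) t + t ^ (n + 1) / (Nat.factorial (n + 1) : ℝ) := by
        ext t; exact expPartialSum_succ _ _
      rw [h]
      simp only [Nat.add_sub_cancel] at ih ⊢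
      rw [expPartialSum_succ]
      refine (ih.fun_add ((hasDerivAt_pow (n + 1) r).div_const _)).congr_deriv ?_
      have := Nat.factorial_ne_zero n
      rw [Nat.factorial_succ, Nat.add_sub_cancel]
      push_cast
      field_simp

lemma mul_expPartialSum_le (n : ℕ) {r : ℝ} (hr : 0 ≤ r) :
    r * expPartialSum n r ≤ n * expPartialSum (n + 1) r := by
  induction n with
  | zero => simp [expPartialSum]
  | succ n ih =>
    have ht : 0 ≤ r ^ (n + 1) / (Nat.factorial (n + 1) : ℝ) := by positivity
    have hS := expPartialSum_nonneg (n + 1) hr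
    have h := pow_succ_div_factorial_succ n r
    rw [expPartialSum_succ (n + 1), expPartialSum_succ n, mul_add, ← h,
      ← expPartialSum_succ n]
    push_cast
    linarith

/-- Log-concavity of the partial sums of the exponential series. -/
lemma expPartialSum_succ_mul_le {m n : ℕ} (hmn : m ≤ n) {r : ℝ} (hr : 0 ≤ r) :
    expPartialSum (n + 1) r * expPartialSum m r ≤
      expPartialSum n r * expPartialSum (m + 1) r := by
  suffices h : r ^ n / (Nat.factorial n : ℝ) * expPartialSum m r ≤
      expPartialSum n r * (r ^ m / (Nat.factorial m : ℝ)) by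
    rw [expPartialSum_succ, expPartialSum_succ]
    linarith
  induction n, hmn using Nat.le_induction with
  | base => rw [mul_comm]
  | succ n _ ih =>
    have ht : 0 ≤ r ^ m / (Nat.factorial m : ℝ) := by positivity
    have hS := expPartialSum_nonneg (n + 1) hr
    have hn : (0 : ℝ) < n + 1 := by positivity
    refine le_of_mul_le_mul_left ?_ hn
    calc (n + 1 : ℝ) * (r ^ (n + 1) / (Nat.factorial (n + 1) : ℝ) * expPartialSum m r)
        = r * (r ^ n / (Nat.factorial n : ℝ) * expPartialSum m r) := by
          rw [← mul_assoc, pow_succ_div_factorial_succ, mul_assoc]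
      _ ≤ r * (expPartialSum n r * (r ^ m / (Nat.factorial m : ℝ))) := by gcongr
      _ = r * expPartialSum n r * (r ^ m / (Nat.factorial m : ℝ)) := by ring
      _ ≤ (n + 1) * expPartialSum (n + 1) r * (r ^ m / (Nat.factorial m : ℝ)) := by
          refine mul_le_mul_of_nonneg_right ?_ ht
          linarith [mul_expPartialSum_le n hr]
      _ = _ := by ring

lemma Z_eq_sum_expPartialSum (K : ℕ) (x r : ℝ) :
    Z K x r = ∑ k ∈ Finset.range (K + 1), x ^ k * expPartialSum (K + 1 - k) r := by
  simp only [Z, expPartialSum, Finset.mul_sum, mul_div_assoc]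

lemma Z_pos (K : ℕ) {x r : ℝ} (hx : 0 ≤ x) (hr : 0 ≤ r) : 0 < Z K x r := by
  rw [Z_eq_sum_expPartialSum, Finset.sum_range_succ']
  have h : 0 ≤ ∑ k ∈ Finset.range K, x ^ (k + 1) * expPartialSum (K + 1 - (k + 1)) r :=
    Finset.sum_nonneg fun _ _ => mul_nonneg (by positivity) (expPartialSum_nonneg _ hr)
  have := one_le_expPartialSum_succ K hr
  simp only [pow_zero, one_mul, Nat.sub_zero]
  linarith

lemma hasDerivAt_Z (K : ℕ) (x r : ℝ) :
    HasDerivAt (Z K x) (∑ k ∈ Finset.range (K + 1), x ^ k * expPartialSum (K - k) r) r := by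
  rw [show Z K x = fun t => ∑ k ∈ Finset.range (K + 1), x ^ k * expPartialSum (K + 1 - k) t from
    funext (Z_eq_sum_expPartialSum K x)]
  refine HasDerivAt.fun_sum fun k _ => ?_
  have h := (hasDerivAt_expPartialSum (K + 1 - k) r).const_mul (x ^ k)
  rwa [show K + 1 - k - 1 = K - k by omega] at h

/-- If f(x,r) = 0 then the partial derivative of f in r is strictly negative. -/
theorem stmt_6 (K : ℕ) (hK : 1 ≤ K) (a : ℝ) (ha : 0 < a) (x r : ℝ)
    (hx : 0 ≤ x) (hr0 : 0 ≤ r) (hra : r < a) (hf : fEq K a x r = 0) :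
    deriv (fun t => fEq K a x t) r < 0 := by
  have hZ := Z_pos K hx hr0
  set D := ∑ k ∈ Finset.range (K + 1), x ^ k * expPartialSum (K - k) r with hD
  have hderiv : HasDerivAt (fun t => fEq K a x t)
      (-1 * Z K x r + (a - r) * D - a * expPartialSum K r) r :=
    (((hasDerivAt_id r).const_sub a).mul (hasDerivAt_Z K x r)).sub
      ((hasDerivAt_expPartialSum (K + 1) r).const_mul a)
  rw [hderiv.deriv]
  have hle : expPartialSum (K + 1) r * D ≤ expPartialSum K r * Z K x r := by
    rw [hD, Z_eq_sum_expPartialSum, Finset.mul_sum, Finset.mul_sum]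
    refine Finset.sum_le_sum fun k hk => ?_
    have hkK : k ≤ K := Nat.lt_succ_iff.mp (Finset.mem_range.mp hk)
    rw [mul_left_comm, mul_left_comm _ (x ^ k), Nat.succ_sub hkK]
    exact mul_le_mul_of_nonneg_left (expPartialSum_succ_mul_le (Nat.sub_le K k) hr0)
      (by positivity)
  have hroot : (a - r) * Z K x r = a * expPartialSum (K + 1) r := sub_eq_zero.mp hf
  have hbound : (a - r) * D ≤ a * expPartialSum K r := by
    refine le_of_mul_le_mul_right ?_ hZ
    calc (a - r) * D * Z K x r = (a - r) * Z K x r * D := by ring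
      _ = a * (expPartialSum (K + 1) r * D) := by rw [hroot, mul_assoc]
      _ ≤ a * (expPartialSum K r * Z K x r) := by gcongr
      _ = a * expPartialSum K r * Z K x r := by ring
  linarith
end

section
/- Fix an integer K ≥ 1 and a real a > 0. There exists a strictly increasing continuous bijection φ from the interval [0, a) onto [0, ∞) such that for all reals ρ_V ≥ 0 and ρ_R with 0 ≤ ρ_R < a, one has f(ρ_V,ρ_R) = 0 if and only if ρ_V = φ(ρ_R). In particular φ(0) = 0 and φ(ρ_R) → ∞ as ρ_R → a⁻. -/
open Finset

/-- Truncated exponential series `Σ_{l < n} r^l / l!`. -/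
noncomputable def truncExp (n : ℕ) (r : ℝ) : ℝ :=
  ∑ l ∈ Finset.range n, r ^ l / (Nat.factorial l : ℝ)

theorem Z_eq_sum_truncExp (K : ℕ) (x r : ℝ) :
    Z K x r = ∑ k ∈ Finset.range (K + 1), x ^ k * truncExp (K + 1 - k) r := by
  simp only [Z, truncExp, Finset.mul_sum, mul_div_assoc]

theorem truncExp_nonneg (n : ℕ) {r : ℝ} (hr : 0 ≤ r) : 0 ≤ truncExp n r :=
  Finset.sum_nonneg fun _ _ => by positivity

theorem one_le_truncExp_succ (n : ℕ) {r : ℝ} (hr : 0 ≤ r) : 1 ≤ truncExp (n + 1) r := by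
  rw [truncExp, Finset.sum_range_succ']
  have : 0 ≤ ∑ l ∈ Finset.range n, r ^ (l + 1) / (Nat.factorial (l + 1) : ℝ) :=
    Finset.sum_nonneg fun _ _ => by positivity
  simpa using this

theorem continuous_truncExp (n : ℕ) : Continuous (truncExp n) := by
  unfold truncExp
  fun_prop

/-- For `m ≤ n`, the ratio `truncExp m / truncExp n` is nonincreasing on `[0, ∞)`. -/
theorem truncExp_mul_truncExp_le {m n : ℕ} (hmn : m ≤ n) {r s : ℝ} (hr : 0 ≤ r) (hrs : r ≤ s) :
    truncExp m s * truncExp n r ≤ truncExp m r * truncExp n s := by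
  have hs : 0 ≤ s := hr.trans hrs
  have split (t : ℝ) : truncExp n t =
      truncExp m t + ∑ l ∈ Finset.Ico m n, t ^ l / (Nat.factorial l : ℝ) :=
    (Finset.sum_range_add_sum_Ico _ hmn).symm
  have tail : truncExp m s * ∑ l ∈ Finset.Ico m n, r ^ l / (Nat.factorial l : ℝ) ≤
      truncExp m r * ∑ l ∈ Finset.Ico m n, s ^ l / (Nat.factorial l : ℝ) := by
    simp only [truncExp, Finset.sum_mul_sum]
    refine Finset.sum_le_sum fun i hi => Finset.sum_le_sum fun j hj => ?_
    have hij : i ≤ j := (Finset.mem_range.1 hi).le.trans (Finset.mem_Ico.1 hj).1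
    obtain ⟨d, rfl⟩ := Nat.exists_eq_add_of_le hij
    rw [div_mul_div_comm, div_mul_div_comm]
    gcongr ?_ / _
    calc s ^ i * r ^ (i + d) = s ^ i * r ^ i * r ^ d := by ring
      _ ≤ s ^ i * r ^ i * s ^ d := by gcongr
      _ = r ^ i * s ^ (i + d) := by ring
  rw [split r, split s]
  linarith

theorem Z_mul_truncExp_le (K : ℕ) {x r s : ℝ} (hx : 0 ≤ x) (hr : 0 ≤ r) (hrs : r ≤ s) :
    Z K x s * truncExp (K + 1) r ≤ Z K x r * truncExp (K + 1) s := by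
  rw [Z_eq_sum_truncExp, Z_eq_sum_truncExp, Finset.sum_mul, Finset.sum_mul]
  refine Finset.sum_le_sum fun k _ => ?_
  rw [mul_assoc, mul_assoc]
  exact mul_le_mul_of_nonneg_left
    (truncExp_mul_truncExp_le (Nat.sub_le _ _) hr hrs) (pow_nonneg hx k)

theorem Z_strictMonoOn {K : ℕ} (hK : 1 ≤ K) {r : ℝ} (hr : 0 ≤ r) :
    StrictMonoOn (fun x => Z K x r) (Set.Ici 0) := by
  intro x hx y _ hxy
  have hx : 0 ≤ x := hx
  simp only [Z_eq_sum_truncExp]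
  refine Finset.sum_lt_sum (fun k _ => ?_) ⟨1, by simp; omega, ?_⟩
  · exact mul_le_mul_of_nonneg_right (pow_le_pow_left₀ hx hxy.le k) (truncExp_nonneg _ hr)
  · obtain ⟨n, rfl⟩ := Nat.exists_eq_add_of_le' hK
    have := one_le_truncExp_succ n hr
    simp only [pow_one, Nat.add_sub_cancel]
    exact mul_lt_mul_of_pos_right hxy (by linarith)

theorem Z_zero_left (K : ℕ) (r : ℝ) : Z K 0 r = truncExp (K + 1) r := by
  rw [Z_eq_sum_truncExp, Finset.sum_range_succ']
  simp

theorem truncExp_add_le_Z {K : ℕ} (hK : 1 ≤ K) {x r : ℝ} (hx : 0 ≤ x) (hr : 0 ≤ r) :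
    truncExp (K + 1) r + x ≤ Z K x r := by
  obtain ⟨n, rfl⟩ := Nat.exists_eq_add_of_le' hK
  rw [Z_eq_sum_truncExp, Finset.sum_range_succ', Finset.sum_range_succ']
  have h : 0 ≤ ∑ k ∈ Finset.range n,
      x ^ (k + 1 + 1) * truncExp (n + 1 + 1 - (k + 1 + 1)) r :=
    Finset.sum_nonneg fun k _ => mul_nonneg (pow_nonneg hx _) (truncExp_nonneg _ hr)
  have h' : x ≤ x * truncExp (n + 1) r := le_mul_of_one_le_right hx (one_le_truncExp_succ n hr)
  simp only [zero_add, pow_one, pow_zero, one_mul, Nat.add_sub_cancel, Nat.sub_zero]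
  linarith

theorem continuous_Z (K : ℕ) : Continuous fun p : ℝ × ℝ => Z K p.1 p.2 := by
  unfold Z
  fun_prop

theorem fEq_eq (K : ℕ) (a x r : ℝ) :
    fEq K a x r = (a - r) * Z K x r - a * truncExp (K + 1) r := rfl

theorem continuous_fEq (K : ℕ) (a : ℝ) : Continuous fun p : ℝ × ℝ => fEq K a p.1 p.2 := by
  simp only [fEq_eq]
  have := continuous_Z K
  have := continuous_truncExp (K + 1)
  fun_prop

theorem exists_fEq_eq_zero_left {K : ℕ} (hK : 1 ≤ K) {a r : ℝ} (hr : 0 ≤ r) (hra : r < a) :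
    ∃ x, 0 ≤ x ∧ fEq K a x r = 0 := by
  have hE := one_le_truncExp_succ K hr
  have har : 0 < a - r := sub_pos.2 hra
  set X := r * truncExp (K + 1) r / (a - r) with hX
  have hX0 : 0 ≤ X := by positivity
  have hXr : (a - r) * X = r * truncExp (K + 1) r := by rw [hX]; field_simp
  have hcont : Continuous fun x => fEq K a x r :=
    (continuous_fEq K a).comp (continuous_id.prodMk continuous_const)
  have hlow : fEq K a 0 r ≤ 0 := by
    rw [fEq_eq, Z_zero_left]
    nlinarith
  have hhigh : 0 ≤ fEq K a X r := by
    rw [fEq_eq]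
    have := mul_le_mul_of_nonneg_left (truncExp_add_le_Z hK hX0 hr) har.le
    linarith
  obtain ⟨x, hx, hfx⟩ := intermediate_value_Icc hX0 hcont.continuousOn ⟨hlow, hhigh⟩
  exact ⟨x, hx.1, hfx⟩

theorem exists_fEq_eq_zero_right {K : ℕ} (hK : 1 ≤ K) {a x : ℝ} (ha : 0 < a) (hx : 0 ≤ x) :
    ∃ r ∈ Set.Ico 0 a, fEq K a x r = 0 := by
  have hcont : Continuous fun r => fEq K a x r :=
    (continuous_fEq K a).comp (continuous_const.prodMk continuous_id)
  have hlow : fEq K a x a < 0 := by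
    have := one_le_truncExp_succ K ha.le
    rw [fEq_eq]
    nlinarith
  have hhigh : 0 ≤ fEq K a x 0 := by
    rw [fEq_eq]
    have := mul_le_mul_of_nonneg_left (truncExp_add_le_Z hK hx le_rfl) ha.le
    nlinarith
  obtain ⟨r, hr, hfr⟩ := intermediate_value_Icc' ha.le hcont.continuousOn ⟨hlow.le, hhigh⟩
  refine ⟨r, ⟨hr.1, hr.2.lt_of_ne ?_⟩, hfr⟩
  rintro rfl
  exact hlow.ne hfr

theorem eq_of_fEq_eq_zero {K : ℕ} (hK : 1 ≤ K) {a x y r : ℝ} (hx : 0 ≤ x) (hy : 0 ≤ y)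
    (hr : 0 ≤ r) (hra : r < a) (hfx : fEq K a x r = 0) (hfy : fEq K a y r = 0) : x = y := by
  rw [fEq_eq] at hfx hfy
  exact (Z_strictMonoOn hK hr).injOn hx hy
    (mul_left_cancel₀ (sub_pos.2 hra).ne' (by linarith))

theorem lt_of_fEq_eq_zero {K : ℕ} (hK : 1 ≤ K) {a x y r s : ℝ} (hx : 0 ≤ x) (hy : 0 ≤ y)
    (hr : 0 ≤ r) (hrs : r < s) (hsa : s < a) (hfx : fEq K a x r = 0) (hfy : fEq K a y s = 0) :
    x < y := by
  by_contra! hyx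
  have hs : 0 ≤ s := hr.trans hrs.le
  have hEr := one_le_truncExp_succ K hr
  have hEs := one_le_truncExp_succ K hs
  have hZ : Z K y s * truncExp (K + 1) r ≤ Z K x r * truncExp (K + 1) s :=
    (mul_le_mul_of_nonneg_right ((Z_strictMonoOn hK hs).monotoneOn hy hx hyx)
      (by linarith)).trans (Z_mul_truncExp_le K hx hr hrs.le)
  rw [fEq_eq, sub_eq_zero] at hfx hfy
  have har : 0 < a - r := by linarith
  have has : 0 < a - s := by linarith
  have hle : (a - r) * (a * truncExp (K + 1) s * truncExp (K + 1) r) ≤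
      (a - s) * (a * truncExp (K + 1) s * truncExp (K + 1) r) :=
    calc (a - r) * (a * truncExp (K + 1) s * truncExp (K + 1) r)
        = (a - r) * (a - s) * (Z K y s * truncExp (K + 1) r) := by rw [← hfy]; ring
      _ ≤ (a - r) * (a - s) * (Z K x r * truncExp (K + 1) s) := by gcongr
      _ = (a - s) * ((a - r) * Z K x r * truncExp (K + 1) s) := by ring
      _ = (a - s) * (a * truncExp (K + 1) s * truncExp (K + 1) r) := by rw [hfx]; ring
  have hpos : 0 < a * truncExp (K + 1) s * truncExp (K + 1) r := by
    have : 0 < a := by linarith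
    positivity
  linarith [le_of_mul_le_mul_right hle hpos]

theorem StrictMonoOn.continuousOn_of_image_ordConnected {f : ℝ → ℝ} {s : Set ℝ}
    [s.OrdConnected] (hf : StrictMonoOn f s) (h : (f '' s).OrdConnected) :
    ContinuousOn f s := by
  rw [continuousOn_iff_continuous_domRestrict]
  exact continuous_subtype_val.comp (hf.orderIso f s).continuous

/-- There is a strictly increasing continuous bijection φ from [0,a) onto [0,∞) with
f(x,r) = 0 ↔ x = φ(r), φ(0) = 0, and φ(r) → ∞ as r → a from the left. -/
theorem stmt_8 (K : ℕ) (hK : 1 ≤ K) (a : ℝ) (ha : 0 < a) :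
    ∃ φ : ℝ → ℝ,
      StrictMonoOn φ (Set.Ico 0 a) ∧
      ContinuousOn φ (Set.Ico 0 a) ∧
      Set.BijOn φ (Set.Ico 0 a) (Set.Ici 0) ∧
      (∀ x : ℝ, 0 ≤ x → ∀ r : ℝ, 0 ≤ r → r < a → (fEq K a x r = 0 ↔ x = φ r)) ∧
      φ 0 = 0 ∧
      Filter.Tendsto φ (nhdsWithin a (Set.Iio a)) Filter.atTop := by
  have hex (r : ℝ) : ∃ x, r ∈ Set.Ico 0 a → 0 ≤ x ∧ fEq K a x r = 0 := by
    by_cases hr : r ∈ Set.Ico 0 a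
    · obtain ⟨x, hx⟩ := exists_fEq_eq_zero_left hK hr.1 hr.2
      exact ⟨x, fun _ => hx⟩
    · exact ⟨0, fun h => absurd h hr⟩
  choose φ hφ using hex
  have hiff (x : ℝ) (hx : 0 ≤ x) (r : ℝ) (hr : 0 ≤ r) (hra : r < a) :
      fEq K a x r = 0 ↔ x = φ r := by
    obtain ⟨h0, hf⟩ := hφ r ⟨hr, hra⟩
    refine ⟨fun h => eq_of_fEq_eq_zero hK hx h0 hr hra h hf, ?_⟩
    rintro rfl
    exact hf
  have hmono : StrictMonoOn φ (Set.Ico 0 a) := fun r hr s hs hrs =>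
    lt_of_fEq_eq_zero hK (hφ r hr).1 (hφ s hs).1 hr.1 hrs hs.2 (hφ r hr).2 (hφ s hs).2
  have hsurj : Set.SurjOn φ (Set.Ico 0 a) (Set.Ici 0) := by
    intro x hx
    obtain ⟨r, hr, hfr⟩ := exists_fEq_eq_zero_right hK ha hx
    exact ⟨r, hr, ((hiff x hx r hr.1 hr.2).1 hfr).symm⟩
  have hbij : Set.BijOn φ (Set.Ico 0 a) (Set.Ici 0) :=
    ⟨fun r hr => (hφ r hr).1, hmono.injOn, hsurj⟩
  refine ⟨φ, hmono, ?_, hbij, hiff, ?_, ?_⟩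
  · exact hmono.continuousOn_of_image_ordConnected (hbij.image_eq ▸ Set.ordConnected_Ici)
  · refine ((hiff 0 le_rfl 0 le_rfl ha).1 ?_).symm
    rw [fEq_eq, Z_zero_left]
    ring
  · refine Filter.tendsto_atTop.2 fun M => ?_
    obtain ⟨r, hr, hM⟩ := hsurj (Set.mem_Ici.2 (le_max_right M 0))
    filter_upwards [Ioo_mem_nhdsLT hr.2] with s hs
    exact (le_max_left M 0).trans
      (hM ▸ (hmono hr ⟨hr.1.trans hs.1.le, hs.2⟩ hs.1).le)
end

section
/- Fix an integer K ≥ 1 and a real a > 0. For all reals ρ_V ≥ 0 and ρ_R with 0 ≤ ρ_R < a such that f(ρ_V,ρ_R) = 0, one has π_{0,·}(ρ_V,ρ_R)·π_S(ρ_V,ρ_R) ≥ π_{0,K}(ρ_V,ρ_R); consequently the three metrics P_b^+ = π_{0,·} + π_S, P_b = π_{0,·} + π_S − π_{0,K}, and U = π_{0,·} + π_S − π_{0,·}·π_S, evaluated at (ρ_V,ρ_R), satisfy P_b^+ ≥ P_b ≥ U. -/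
open Finset

/-- The ratio of the last term to the partial sum of the exponential series decreases with the
truncation order. -/
theorem pow_div_factorial_mul_sum_le {r : ℝ} (hr : 0 ≤ r) {n m : ℕ} (h : n ≤ m) :
    r ^ m / (Nat.factorial m : ℝ) * ∑ l ∈ range (n + 1), r ^ l / (Nat.factorial l : ℝ)
      ≤ r ^ n / (Nat.factorial n : ℝ) * ∑ l ∈ range (m + 1), r ^ l / (Nat.factorial l : ℝ) := by
  have succ_term (k : ℕ) : r ^ (k + 1) / (Nat.factorial (k + 1) : ℝ)
      = r / ((k : ℝ) + 1) * (r ^ k / (Nat.factorial k : ℝ)) := by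
    rw [pow_succ, Nat.factorial_succ]
    push_cast
    field_simp
  induction n generalizing m with
  | zero =>
    simpa using single_le_sum (f := fun l : ℕ => r ^ l / (Nat.factorial l : ℝ))
      (fun l _ => by positivity) (self_mem_range_succ m)
  | succ n ih =>
    obtain ⟨m, rfl⟩ : ∃ k, m = k + 1 := ⟨m - 1, by omega⟩
    have hnm : n ≤ m := by omega
    have hcoef : r / ((m : ℝ) + 1) ≤ r / ((n : ℝ) + 1) := by gcongr
    have key := mul_le_mul hcoef (ih hnm) (by positivity) (by positivity)
    rw [← mul_assoc, ← mul_assoc, ← succ_term, ← succ_term] at key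
    rw [sum_range_succ _ (n + 1), sum_range_succ _ (m + 1)]
    linarith

/-- Unnormalized form of `π_{0,K} ≤ π_{0,·} π_S`. -/
theorem pow_div_factorial_mul_Z_le (K : ℕ) {x r : ℝ} (hx : 0 ≤ x) (hr : 0 ≤ r) :
    r ^ K / (Nat.factorial K : ℝ) * Z K x r
      ≤ (∑ l ∈ range (K + 1), r ^ l / (Nat.factorial l : ℝ))
        * ∑ k ∈ range (K + 1), x ^ k * r ^ (K - k) / (Nat.factorial (K - k) : ℝ) := by
  rw [Z, mul_sum, mul_sum]
  refine sum_le_sum fun k hk => ?_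
  have hkK : K + 1 - k = (K - k) + 1 := by have := mem_range.mp hk; omega
  have key := mul_le_mul_of_nonneg_left
    (pow_div_factorial_mul_sum_le hr (Nat.sub_le K k)) (pow_nonneg hx k)
  simp only [hkK, mul_div_assoc, ← mul_sum] at key ⊢
  linarith

theorem piP_le_piZero_mul_piSat (K : ℕ) {x r : ℝ} (hx : 0 ≤ x) (hr : 0 ≤ r) :
    piP K x r 0 K ≤ piZero K x r * piSat K x r := by
  simp only [piZero, piSat, piP, pow_zero, one_mul, ← div_div, ← sum_div]
  by_cases hZ : Z K x r = 0
  · simp [hZ]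
  · rw [div_mul_div_comm, ← mul_div_mul_right _ _ hZ]
    exact div_le_div_of_nonneg_right (pow_div_factorial_mul_Z_le K hx hr) (mul_self_nonneg _)

/-- At equilibrium, piZero * piSat ≥ π_{0,K}; hence Pb+ ≥ Pb ≥ U. -/
theorem stmt_11 (K : ℕ) (hK : 1 ≤ K) (a : ℝ) (ha : 0 < a) (x r : ℝ)
    (hx : 0 ≤ x) (hr0 : 0 ≤ r) (hra : r < a) (hf : fEq K a x r = 0) :
    piZero K x r * piSat K x r ≥ piP K x r 0 K
    ∧ piZero K x r + piSat K x r
        ≥ piZero K x r + piSat K x r - piP K x r 0 K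
    ∧ piZero K x r + piSat K x r - piP K x r 0 K
        ≥ piZero K x r + piSat K x r - piZero K x r * piSat K x r := by
  have key := piP_le_piZero_mul_piSat K hx hr0
  have hZ : 0 ≤ Z K x r := sum_nonneg fun k _ => sum_nonneg fun l _ => by positivity
  have hP : 0 ≤ piP K x r 0 K := by
    unfold piP
    positivity
  exact ⟨key, by linarith, by linarith⟩
end

section
/- Fix an integer K ≥ 1 and a real a > 0. For all reals ρ_V > 0 and ρ_R with 0 ≤ ρ_R < a, if f(ρ_V,ρ_R) = 0, then f(1/ρ_V, ρ_R/ρ_V) = 0 and 0 ≤ ρ_R/ρ_V < a. (Equivalently, the inverse ψ of the diffeomorphism of the zero set of f satisfies ψ(1/ρ_V) = ψ(ρ_V)/ρ_V.) -/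
open Finset

theorem Z_eq_sum_geom (K : ℕ) (x r : ℝ) :
    Z K x r = ∑ l ∈ range (K + 1), (∑ k ∈ range (K + 1 - l), x ^ k) *
      (r ^ l / (Nat.factorial l : ℝ)) := by
  unfold Z
  simp_rw [sum_mul, ← mul_div_assoc]
  apply sum_comm'
  intro k l
  simp only [mem_range]
  omega

theorem Z_nonneg (K : ℕ) {x r : ℝ} (hx : 0 ≤ x) (hr : 0 ≤ r) : 0 ≤ Z K x r := by
  unfold Z
  positivity

theorem sum_pow_div_factorial_pos (K : ℕ) {r : ℝ} (hr : 0 ≤ r) :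
    0 < ∑ l ∈ range (K + 1), r ^ l / (Nat.factorial l : ℝ) :=
  sum_pos' (fun l _ => by positivity) ⟨0, by simp⟩

theorem pow_mul_Z_inv (K : ℕ) {x : ℝ} (hx : x ≠ 0) (r : ℝ) :
    x ^ K * Z K (1 / x) (r / x) = Z K x r := by
  rw [Z_eq_sum_geom, Z_eq_sum_geom, mul_sum]
  refine sum_congr rfl fun l hl => ?_
  have hlK : l ≤ K := by simpa [Nat.lt_succ_iff] using hl
  rw [← sum_range_reflect (fun k => x ^ k), sum_mul, sum_mul, mul_sum]
  refine sum_congr rfl fun k hk => ?_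
  have hk' := mem_range.mp hk
  obtain ⟨m, rfl⟩ : ∃ m, K = m + k + l := ⟨K - k - l, by omega⟩
  rw [show m + k + l + 1 - l - 1 - k = m by omega]
  rw [pow_add, pow_add, div_pow, div_pow, one_pow]
  field_simp

theorem one_sub_mul_Z (K : ℕ) {x : ℝ} (hx : x ≠ 0) (r : ℝ) :
    (1 - x) * Z K x r = ∑ l ∈ range (K + 1), r ^ l / (Nat.factorial l : ℝ) -
      x ^ (K + 1) * ∑ l ∈ range (K + 1), (r / x) ^ l / (Nat.factorial l : ℝ) := by
  rw [Z_eq_sum_geom, mul_sum, mul_sum, ← sum_sub_distrib]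
  refine sum_congr rfl fun l hl => ?_
  have hlK : l ≤ K := by simpa [Nat.lt_succ_iff] using hl
  rw [← mul_assoc, mul_neg_geom_sum]
  obtain ⟨m, rfl⟩ : ∃ m, K = m + l := ⟨K - l, by omega⟩
  rw [show m + l + 1 - l = m + 1 by omega]
  rw [div_pow]
  field_simp
  ring

theorem pow_mul_fEq_inv (K : ℕ) (a : ℝ) {x : ℝ} (hx : x ≠ 0) (r : ℝ) :
    x ^ (K + 1) * fEq K a (1 / x) (r / x) = fEq K a x r := by
  have h₁ := pow_mul_Z_inv K hx r
  have h₂ := one_sub_mul_Z K hx r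
  have h₃ : x * (r / x) = r := mul_div_cancel₀ r hx
  unfold fEq
  linear_combination (a * x - r) * h₁ - a * h₂ - x ^ K * Z K (1 / x) (r / x) * h₃

/-- If f(x,r) = 0 with x > 0 and 0 ≤ r < a, then f(1/x, r/x) = 0 and 0 ≤ r/x < a. -/
theorem stmt_12 (K : ℕ) (hK : 1 ≤ K) (a : ℝ) (ha : 0 < a) (x r : ℝ)
    (hx : 0 < x) (hr0 : 0 ≤ r) (hra : r < a) (hf : fEq K a x r = 0) :
    fEq K a (1 / x) (r / x) = 0 ∧ 0 ≤ r / x ∧ r / x < a := by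
  have h : fEq K a (1 / x) (r / x) = 0 := by
    have h' := pow_mul_fEq_inv K a hx.ne' r
    rw [hf] at h'
    exact (mul_eq_zero.mp h').resolve_left (pow_ne_zero _ hx.ne')
  have hrx : 0 ≤ r / x := div_nonneg hr0 hx.le
  refine ⟨h, hrx, sub_pos.mp ?_⟩
  have hpos := mul_pos ha (sum_pow_div_factorial_pos K hrx)
  rw [← sub_eq_zero.mp h] at hpos
  exact pos_of_mul_pos_left hpos (Z_nonneg K (by positivity) hrx)
end

section
/- Fix an integer K ≥ 1. For all reals ρ_V > 0 and ρ_R ≥ 0, the proportion of problematic stations is invariant under the symmetry (ρ_V,ρ_R) ↦ (1/ρ_V, ρ_R/ρ_V): one has π_{0,K}(1/ρ_V, ρ_R/ρ_V) = π_{0,K}(ρ_V,ρ_R), and consequently P_b(1/ρ_V, ρ_R/ρ_V) = P_b(ρ_V,ρ_R) and P_b^+(1/ρ_V, ρ_R/ρ_V) = P_b^+(ρ_V,ρ_R), where P_b = π_{0,·} + π_S − π_{0,K} and P_b^+ = π_{0,·} + π_S. -/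
open Finset

lemma inv_pow_mul_div_pow {K k l : ℕ} {x : ℝ} (r : ℝ) (hx : x ≠ 0) (h : k + l ≤ K) :
    (1 / x) ^ k * (r / x) ^ l = x ^ (K - k - l) * r ^ l / x ^ K := by
  obtain ⟨m, rfl⟩ := Nat.exists_eq_add_of_le h
  have hm : k + l + m - k - l = m := by omega
  rw [hm, div_pow, div_pow, one_pow]
  field_simp
  ring

lemma Z_eq_sum_swap (K : ℕ) (x r : ℝ) :
    Z K x r = ∑ l ∈ Finset.range (K + 1), ∑ k ∈ Finset.range (K + 1 - l),
      x ^ k * r ^ l / (Nat.factorial l : ℝ) := by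
  unfold Z
  refine Finset.sum_comm' fun k l => ?_
  simp only [Finset.mem_range]
  omega

lemma Z_one_div (K : ℕ) {x : ℝ} (r : ℝ) (hx : x ≠ 0) :
    Z K (1 / x) (r / x) = Z K x r / x ^ K := by
  rw [Z_eq_sum_swap, Z_eq_sum_swap, Finset.sum_div]
  refine Finset.sum_congr rfl fun l hl => ?_
  rw [Finset.sum_div, ← Finset.sum_range_reflect]
  refine Finset.sum_congr rfl fun k hk => ?_
  rw [Finset.mem_range] at hl hk
  have hkl : K - (K + 1 - l - 1 - k) - l = k := by omega
  rw [inv_pow_mul_div_pow r hx (K := K) (by omega), hkl]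
  ring

lemma piP_one_div {K k l : ℕ} {x : ℝ} (r : ℝ) (hx : x ≠ 0) (h : k + l ≤ K) :
    piP K (1 / x) (r / x) k l = piP K x r (K - k - l) l := by
  unfold piP
  rw [Z_one_div K r hx, inv_pow_mul_div_pow r hx h, ← mul_div_assoc,
    div_div_div_cancel_right₀ (pow_ne_zero K hx)]

lemma piZero_one_div (K : ℕ) {x : ℝ} (r : ℝ) (hx : x ≠ 0) :
    piZero K (1 / x) (r / x) = piSat K x r := by
  unfold piZero piSat
  rw [← Finset.sum_range_reflect]
  refine Finset.sum_congr rfl fun k hk => ?_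
  rw [Finset.mem_range] at hk
  have hl : K + 1 - 1 - k = K - k := by omega
  have hk' : K - 0 - (K - k) = k := by omega
  rw [hl, piP_one_div r hx (by omega), hk']

lemma piSat_one_div (K : ℕ) {x : ℝ} (r : ℝ) (hx : x ≠ 0) :
    piSat K (1 / x) (r / x) = piZero K x r := by
  have h := piZero_one_div K (r / x) (one_div_ne_zero hx)
  rwa [one_div_one_div, div_div_div_cancel_right₀ hx, div_one, eq_comm] at h

/-- Symmetry of the problematic-station metric: π_{0,K}, Pb and Pb+ are invariant
under (x, r) ↦ (1/x, r/x). -/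
theorem stmt_14 (K : ℕ) (hK : 1 ≤ K) (x r : ℝ) (hx : 0 < x) (hr : 0 ≤ r) :
    piP K (1 / x) (r / x) 0 K = piP K x r 0 K
    ∧ Pb K (1 / x) (r / x) = Pb K x r
    ∧ PbPlus K (1 / x) (r / x) = PbPlus K x r := by
  have hx' : x ≠ 0 := hx.ne'
  have h0 : piP K (1 / x) (r / x) 0 K = piP K x r 0 K := by
    simpa using piP_one_div r hx' (Nat.zero_add K).le
  have hs : PbPlus K (1 / x) (r / x) = PbPlus K x r := by
    unfold PbPlus
    rw [piZero_one_div K r hx', piSat_one_div K r hx', add_comm]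
  refine ⟨h0, ?_, hs⟩
  unfold PbPlus at hs
  unfold Pb
  rw [hs, h0]
end

section
/- Fix an integer K ≥ 1. Let 0 < a and α > 1, and for a real b > 0 define f_b(x,r) = (1 − r/b)·Z(x,r) − Σ_{l=0}^{K} r^l/l!. For all reals ρ_V > 0 and ρ_R with 0 < ρ_R < a, if f_a(ρ_V, ρ_R) = 0 then f_{αa}(ρ_V, α·ρ_R) < 0. -/
open Finset

/-- The normalized equilibrium function fb with traffic b. -/
noncomputable def fb (K : ℕ) (b x r : ℝ) : ℝ :=
  (1 - r / b) * Z K x r - ∑ l ∈ Finset.range (K + 1), r ^ l / (Nat.factorial l : ℝ)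

/-- The ratio of two truncated exponential series, the shorter one over the longer one,
strictly decreases when the argument is scaled up. -/
theorem truncExp_mul_lt_of_scale {n N : ℕ} (hn : 0 < n) (hnN : n < N) {r α : ℝ}
    (hr : 0 < r) (hα : 1 < α) :
    (∑ l ∈ Finset.range N, r ^ l / (Nat.factorial l : ℝ)) *
        ∑ l ∈ Finset.range n, (α * r) ^ l / (Nat.factorial l : ℝ) <
      (∑ l ∈ Finset.range N, (α * r) ^ l / (Nat.factorial l : ℝ)) *
        ∑ l ∈ Finset.range n, r ^ l / (Nat.factorial l : ℝ) := by
  obtain ⟨m, rfl⟩ : ∃ m, n = m + 1 := ⟨n - 1, by omega⟩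
  have scale (l : ℕ) : (α * r) ^ l / (Nat.factorial l : ℝ) =
      α ^ l * (r ^ l / (Nat.factorial l : ℝ)) := by
    rw [mul_pow, mul_div_assoc]
  have hhead : ∑ l ∈ Finset.range (m + 1), (α * r) ^ l / (Nat.factorial l : ℝ) ≤
      α ^ m * ∑ l ∈ Finset.range (m + 1), r ^ l / (Nat.factorial l : ℝ) := by
    rw [Finset.mul_sum]
    refine Finset.sum_le_sum fun l hl => ?_
    rw [scale]
    have hlm : l ≤ m := Nat.lt_succ_iff.mp (Finset.mem_range.mp hl)
    exact mul_le_mul_of_nonneg_right (pow_le_pow_right₀ hα.le hlm) (by positivity)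
  have htail : α ^ (m + 1) * ∑ l ∈ Finset.Ico (m + 1) N, r ^ l / (Nat.factorial l : ℝ) ≤
      ∑ l ∈ Finset.Ico (m + 1) N, (α * r) ^ l / (Nat.factorial l : ℝ) := by
    rw [Finset.mul_sum]
    refine Finset.sum_le_sum fun l hl => ?_
    rw [scale]
    exact mul_le_mul_of_nonneg_right (pow_le_pow_right₀ hα.le (Finset.mem_Ico.mp hl).1)
      (by positivity)
  have hheadpos : 0 < ∑ l ∈ Finset.range (m + 1), r ^ l / (Nat.factorial l : ℝ) :=
    Finset.sum_pos (fun l _ => by positivity) ⟨0, by simp⟩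
  have htailpos : 0 < ∑ l ∈ Finset.Ico (m + 1) N, r ^ l / (Nat.factorial l : ℝ) :=
    Finset.sum_pos (fun l _ => by positivity) ⟨m + 1, by simpa using hnN⟩
  rw [← Finset.sum_range_add_sum_Ico _ hnN.le,
    ← Finset.sum_range_add_sum_Ico (fun l => (α * r) ^ l / (Nat.factorial l : ℝ)) hnN.le]
  set A := ∑ l ∈ Finset.range (m + 1), r ^ l / (Nat.factorial l : ℝ)
  set B := ∑ l ∈ Finset.range (m + 1), (α * r) ^ l / (Nat.factorial l : ℝ)
  set T := ∑ l ∈ Finset.Ico (m + 1) N, r ^ l / (Nat.factorial l : ℝ)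
  set U := ∑ l ∈ Finset.Ico (m + 1) N, (α * r) ^ l / (Nat.factorial l : ℝ)
  have hcross : T * B < U * A :=
    calc T * B ≤ T * (α ^ m * A) := by gcongr
      _ = α ^ m * (T * A) := by ring
      _ < α ^ (m + 1) * (T * A) := by gcongr; omega
      _ = α ^ (m + 1) * T * A := by ring
      _ ≤ U * A := by gcongr
  linarith [add_mul A T B, add_mul B U A, mul_comm A B]

theorem Z_eq_sum_pow_mul (K : ℕ) (x r : ℝ) :
    Z K x r = ∑ k ∈ Finset.range (K + 1),
      x ^ k * ∑ l ∈ Finset.range (K + 1 - k), r ^ l / (Nat.factorial l : ℝ) := by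
  simp only [Z, Finset.mul_sum, mul_div_assoc]

/-- The ratio of `Z K x` to the truncated exponential series strictly decreases when the
argument is scaled up. -/
theorem truncExp_mul_Z_lt_of_scale {K : ℕ} (hK : 1 ≤ K) {x r α : ℝ} (hx : 0 < x)
    (hr : 0 < r) (hα : 1 < α) :
    (∑ l ∈ Finset.range (K + 1), r ^ l / (Nat.factorial l : ℝ)) * Z K x (α * r) <
      (∑ l ∈ Finset.range (K + 1), (α * r) ^ l / (Nat.factorial l : ℝ)) * Z K x r := by
  rw [Z_eq_sum_pow_mul, Z_eq_sum_pow_mul, Finset.mul_sum, Finset.mul_sum]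
  have hlt (k : ℕ) (hk : k ∈ Finset.range (K + 1)) (hk0 : 0 < k) :=
    mul_lt_mul_of_pos_left
      (truncExp_mul_lt_of_scale (n := K + 1 - k) (N := K + 1)
        (by have := Finset.mem_range.mp hk; omega) (by omega) hr hα)
      (pow_pos hx k)
  refine Finset.sum_lt_sum (fun k hk => ?_) ⟨1, by simp; omega, ?_⟩
  · rcases Nat.eq_zero_or_pos k with rfl | hk0
    · simp only [pow_zero, one_mul, Nat.sub_zero]
      exact (mul_comm _ _).le
    · rw [mul_left_comm, mul_left_comm _ (x ^ k)]
      exact (hlt k hk hk0).le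
  · rw [mul_left_comm, mul_left_comm _ (x ^ 1)]
    exact hlt 1 (by simp; omega) one_pos

/-- If fb a (x, r) = 0 with 0 < r < a, then fb (αa) (x, αr) < 0 for α > 1. -/
theorem stmt_16 (K : ℕ) (hK : 1 ≤ K) (a α : ℝ) (ha : 0 < a) (hα : 1 < α)
    (x r : ℝ) (hx : 0 < x) (hr0 : 0 < r) (hra : r < a)
    (hf : fb K a x r = 0) :
    fb K (α * a) x (α * r) < 0 := by
  have hratio : α * r / (α * a) = r / a := mul_div_mul_left r a (by positivity)
  have hc : 0 < 1 - r / a := sub_pos.mpr ((div_lt_one ha).mpr hra)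
  have hpos : 0 < ∑ l ∈ Finset.range (K + 1), r ^ l / (Nat.factorial l : ℝ) :=
    Finset.sum_pos (fun l _ => by positivity) ⟨0, by simp⟩
  have hlt := mul_lt_mul_of_pos_left (truncExp_mul_Z_lt_of_scale hK hx hr0 hα) hc
  unfold fb at hf ⊢
  rw [hratio, sub_neg]
  rw [sub_eq_zero] at hf
  refine lt_of_mul_lt_mul_left ?_ hpos.le
  rw [mul_left_comm, mul_left_comm _ _ (Z K x r), hf] at hlt
  rw [mul_comm _ (∑ l ∈ Finset.range (K + 1), (α * r) ^ l / (Nat.factorial l : ℝ))]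
  exact hlt
end

section
/- Fix an integer K ≥ 1 and reals 0 < a < a'. Let ρ_V > 0, let ρ_R with 0 ≤ ρ_R < a satisfy f_a(ρ_V,ρ_R) = 0, and let ρ_R' with 0 ≤ ρ_R' < a' satisfy f_{a'}(ρ_V,ρ_R') = 0. Then ρ_R'/a' < ρ_R/a, and consequently the approximate proportion of problematic stations P_b^+ = 2 − (ρ_R/a)·(1 + 1/ρ_V) at traffic a is strictly smaller than 2 − (ρ_R'/a')·(1 + 1/ρ_V) at traffic a'; i.e., at fixed ρ_V, P_b^+ is strictly increasing in the traffic ratio. -/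
open Finset

theorem truncExp_succ (n : ℕ) (r : ℝ) :
    truncExp (n + 1) r = truncExp n r + r ^ n / (Nat.factorial n : ℝ) :=
  Finset.sum_range_succ _ _

theorem truncExp_pos {n : ℕ} (hn : 0 < n) {r : ℝ} (hr : 0 ≤ r) : 0 < truncExp n r :=
  Finset.sum_pos' (fun l _ => by positivity) ⟨0, Finset.mem_range.2 hn, by simp⟩

theorem truncExp_mul_pow_lt {m n : ℕ} (hm : 0 < m) (hmn : m ≤ n) {r s : ℝ} (hr : 0 ≤ r)
    (hrs : r < s) : truncExp m s * r ^ n < truncExp m r * s ^ n := by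
  have hs : 0 ≤ s := hr.trans hrs.le
  simp only [truncExp, Finset.sum_mul]
  refine Finset.sum_lt_sum (fun l hl => ?_) ⟨0, Finset.mem_range.2 hm, ?_⟩
  · obtain ⟨d, rfl⟩ : ∃ d, n = l + d :=
      Nat.exists_eq_add_of_le ((Finset.mem_range.1 hl).le.trans hmn)
    calc s ^ l / (Nat.factorial l : ℝ) * r ^ (l + d)
        = r ^ l / (Nat.factorial l : ℝ) * s ^ l * r ^ d := by ring
      _ ≤ r ^ l / (Nat.factorial l : ℝ) * s ^ l * s ^ d := by gcongr
      _ = r ^ l / (Nat.factorial l : ℝ) * s ^ (l + d) := by ring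
  · simpa using pow_lt_pow_left₀ hrs hr (hm.trans_le hmn).ne'

theorem truncExp_mul_truncExp_lt {m n : ℕ} (hm : 0 < m) (hmn : m < n) {r s : ℝ} (hr : 0 ≤ r)
    (hrs : r < s) : truncExp m s * truncExp n r < truncExp m r * truncExp n s := by
  have step : ∀ j, m ≤ j → truncExp m s * (r ^ j / (Nat.factorial j : ℝ)) <
      truncExp m r * (s ^ j / (Nat.factorial j : ℝ)) := fun j hj => by
    rw [← mul_div_assoc, ← mul_div_assoc]
    exact div_lt_div_of_pos_right (truncExp_mul_pow_lt hm hj hr hrs) (by positivity)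
  induction n, Nat.succ_le_of_lt hmn using Nat.le_induction with
  | base =>
    rw [truncExp_succ, truncExp_succ]
    linarith [step m le_rfl]
  | succ n hn ih =>
    rw [truncExp_succ n, truncExp_succ n]
    linarith [step n (Nat.le_of_succ_le hn), ih hn]

/-- `Z / truncExp (K + 1)` is strictly decreasing in its last argument. -/
theorem Z_mul_truncExp_lt {K : ℕ} (hK : 1 ≤ K) {x r s : ℝ} (hx : 0 < x) (hr : 0 ≤ r)
    (hrs : r < s) : Z K x s * truncExp (K + 1) r < Z K x r * truncExp (K + 1) s := by
  have key : ∀ k, 1 ≤ k → k ≤ K → x ^ k * truncExp (K + 1 - k) s * truncExp (K + 1) r <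
      x ^ k * truncExp (K + 1 - k) r * truncExp (K + 1) s := fun k hk hkK => by
    rw [mul_assoc, mul_assoc]
    exact mul_lt_mul_of_pos_left
      (truncExp_mul_truncExp_lt (by lia) (by lia) hr hrs) (by positivity)
  rw [Z_eq_sum_truncExp, Z_eq_sum_truncExp, Finset.sum_mul, Finset.sum_mul]
  refine Finset.sum_lt_sum (fun k hk => ?_) ⟨1, Finset.mem_range.2 (by lia), key 1 le_rfl hK⟩
  rcases Nat.eq_zero_or_pos k with rfl | hk0
  · simp [mul_comm]
  · exact (key k hk0 (Nat.lt_succ_iff.1 (Finset.mem_range.1 hk))).le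

theorem truncExp_lt_Z {K : ℕ} (hK : 1 ≤ K) {x r : ℝ} (hx : 0 < x) (hr : 0 ≤ r) :
    truncExp (K + 1) r < Z K x r := by
  rw [Z_eq_sum_truncExp, Finset.sum_range_succ']
  have : 0 < ∑ k ∈ Finset.range K, x ^ (k + 1) * truncExp (K + 1 - (k + 1)) r :=
    Finset.sum_pos (fun k hk => mul_pos (by positivity)
      (truncExp_pos (by have := Finset.mem_range.1 hk; lia) hr)) ⟨0, Finset.mem_range.2 hK⟩
  simpa using this

theorem fb_eq_zero_iff {K : ℕ} {b x r : ℝ} :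
    fb K b x r = 0 ↔ (1 - r / b) * Z K x r = truncExp (K + 1) r :=
  sub_eq_zero

/-- At fixed x = ρ_V, the approximate proportion of problematic stations
Pb+ = 2 - (r/b)(1 + 1/x) is strictly increasing in the traffic ratio b. -/
theorem stmt_17 (K : ℕ) (hK : 1 ≤ K) (a a' : ℝ) (ha : 0 < a) (haa : a < a')
    (x : ℝ) (hx : 0 < x) (r r' : ℝ)
    (hr0 : 0 ≤ r) (hra : r < a) (hfr : fb K a x r = 0)
    (hr0' : 0 ≤ r') (hra' : r' < a') (hfr' : fb K a' x r' = 0) :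
    r' / a' < r / a
    ∧ 2 - (r / a) * (1 + 1 / x) < 2 - (r' / a') * (1 + 1 / x) := by
  have ha' : 0 < a' := ha.trans haa
  rw [fb_eq_zero_iff] at hfr hfr'
  have hE := truncExp_pos K.succ_pos hr0
  have hE' := truncExp_pos K.succ_pos hr0'
  have hZ := truncExp_lt_Z hK hx hr0
  have hZ' := truncExp_lt_Z hK hx hr0'
  have hu : 0 < r / a := by
    by_contra! h
    nlinarith
  have hlt : r' / a' < r / a := by
    by_contra! h
    have hrr : r < r' := by
      calc r = r / a * a := by field_simp
        _ < r / a * a' := by gcongr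
        _ ≤ r' / a' * a' := by gcongr
        _ = r' := by field_simp
    have hmono := Z_mul_truncExp_lt hK hx hr0 hrr
    rw [← hfr, ← hfr'] at hmono
    have hpos : 0 < Z K x r * Z K x r' := mul_pos (hE.trans hZ) (hE'.trans hZ')
    nlinarith
  refine ⟨hlt, sub_lt_sub_left (mul_lt_mul_of_pos_right hlt (by positivity)) 2⟩
end
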